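/- Let E be a nonabelian finite group that is nilpotent of class 2 with cyclic center. Then E has a faithful irreducible complex representation, and its degree equals [E : Z(E)]^{1/2}. -/

import Mathlib

open scoped BigOperators

/-- A representation is irreducible if it is nonzero and has no proper nontrivial
invariant subspaces. -/
def RepIrreducible {G V : Type*} [Monoid G] [AddCommGroup V] [Module ℂ V]
    (ρ : Representation ℂ G V) : Prop :=
  (⊤ : Submodule ℂ V) ≠ ⊥ ∧
    ∀ U : Submodule ℂ V, (∀ g v, v ∈ U → ρ g v ∈ U) → U = ⊥ ∨ U = ⊤

/-- The character of a representation. -/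
noncomputable def repChar {G V : Type*} [Monoid G] [AddCommGroup V] [Module ℂ V]
    (ρ : Representation ℂ G V) (g : G) : ℂ := LinearMap.trace ℂ V (ρ g)

namespace RepIrreducible

variable {G V : Type*} [Monoid G] [AddCommGroup V] [Module ℂ V] {ρ : Representation ℂ G V}

theorem isIrreducible (h : RepIrreducible ρ) : ρ.IsIrreducible where
  exists_pair_ne := ⟨⊥, ⊤, fun e => h.1 (congrArg Subrepresentation.toSubmodule e).symm⟩
  eq_bot_or_eq_top U := (h.2 U.toSubmodule fun g _ hv => U.apply_mem_toSubmodule g hv).imp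
    (fun e => Subrepresentation.toSubmodule_injective e)
    (fun e => Subrepresentation.toSubmodule_injective e)

end RepIrreducible

/-- Every nonzero finite-dimensional subrepresentation contains an irreducible one. -/
theorem Subrepresentation.exists_le_repIrreducible {G V : Type*} [Monoid G] [AddCommGroup V]
    [Module ℂ V] [FiniteDimensional ℂ V] {ρ : Representation ℂ G V} (W : Subrepresentation ρ)
    (hW : W.toSubmodule ≠ ⊥) :
    ∃ τ : Subrepresentation ρ, τ.toSubmodule ≤ W.toSubmodule ∧
      RepIrreducible τ.toRepresentation := by
  obtain ⟨U, ⟨hU0, hUW, hUinv⟩, hmin⟩ := (wellFounded_lt (α := Submodule ℂ V)).has_min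
    {U | U ≠ ⊥ ∧ U ≤ W.toSubmodule ∧ ∀ g v, v ∈ U → ρ g v ∈ U}
    ⟨W.toSubmodule, hW, le_rfl, fun g _ hv => W.apply_mem_toSubmodule g hv⟩
  refine ⟨⟨U, hUinv⟩, hUW, ?_, fun X hX => or_iff_not_imp_left.2 fun hX0 => ?_⟩
  · have := Submodule.nontrivial_iff_ne_bot.2 hU0
    exact top_ne_bot
  · have hle : X.map U.subtype ≤ U := Submodule.map_subtype_le U X
    have hXU : X.map U.subtype = U := by
      by_contra hne
      refine hmin (X.map U.subtype) ⟨?_, hle.trans hUW, ?_⟩ (lt_of_le_of_ne hle hne)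
      · rwa [Ne, ← Submodule.map_bot U.subtype,
          (Submodule.map_injective_of_injective U.injective_subtype).eq_iff]
      · rintro g _ ⟨x, hx, rfl⟩
        exact ⟨_, hX g x hx, rfl⟩
    apply Submodule.map_injective_of_injective U.injective_subtype
    rw [hXU, Submodule.map_subtype_top]

/-- The right regular representation of `G` on functions on a type in bijection with `G`. -/
def rightRegular {G ι : Type*} [Group G] (e : G ≃ ι) : Representation ℂ G (ι → ℂ) where
  toFun g := LinearMap.funLeft ℂ ℂ fun i => e (e.symm i * g)
  map_one' := by ext; simp [LinearMap.funLeft]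
  map_mul' g h := by ext; simp [LinearMap.funLeft, mul_assoc]

theorem rightRegular_apply {G ι : Type*} [Group G] (e : G ≃ ι) (g : G) (f : ι → ℂ) (i : ι) :
    rightRegular e g f i = f (e (e.symm i * g)) := rfl

/-- The subrepresentation on which the center acts through the character `χ`. -/
def centralIsotypic {G V : Type*} [Group G] [AddCommGroup V] [Module ℂ V]
    (ρ : Representation ℂ G V) (χ : Subgroup.center G →* ℂˣ) : Subrepresentation ρ where
  toSubmodule := ⨅ z : Subgroup.center G, LinearMap.ker (ρ z - (χ z : ℂ) • LinearMap.id)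
  apply_mem_toSubmodule g v hv := by
    simp only [Submodule.mem_iInf, LinearMap.mem_ker, LinearMap.sub_apply, LinearMap.smul_apply,
      LinearMap.id_apply, sub_eq_zero] at hv ⊢
    intro z
    rw [← Module.End.mul_apply, ← map_mul, ← Subgroup.mem_center_iff.1 z.2 g, map_mul,
      Module.End.mul_apply, hv z, map_smul]

theorem mem_centralIsotypic {G V : Type*} [Group G] [AddCommGroup V] [Module ℂ V]
    {ρ : Representation ℂ G V} {χ : Subgroup.center G →* ℂˣ} {v : V} :
    v ∈ (centralIsotypic ρ χ).toSubmodule ↔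
      ∀ z : Subgroup.center G, ρ z v = (χ z : ℂ) • v := by
  simp [centralIsotypic, sub_eq_zero]

theorem centralIsotypic_rightRegular_ne_bot {G ι : Type*} [Group G] (e : G ≃ ι)
    (χ : Subgroup.center G →* ℂˣ) :
    (centralIsotypic (rightRegular e) χ).toSubmodule ≠ ⊥ := by
  classical
  let f : ι → ℂ := fun i =>
    if h : e.symm i ∈ Subgroup.center G then (χ ⟨e.symm i, h⟩ : ℂ) else 0
  have hf : f ∈ (centralIsotypic (rightRegular e) χ).toSubmodule := by
    refine mem_centralIsotypic.2 fun z => funext fun i => ?_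
    rw [rightRegular_apply]
    by_cases h : e.symm i ∈ Subgroup.center G
    · have h' := mul_mem h z.2
      have hz : (⟨e.symm i * z, h'⟩ : Subgroup.center G) = z * ⟨e.symm i, h⟩ :=
        Subtype.ext (Subgroup.mem_center_iff.1 z.2 _)
      simp [f, h, h', hz]
    · have h' : e.symm i * z ∉ Subgroup.center G := by
        rwa [Subgroup.mul_mem_cancel_right _ z.2]
      simp [f, h, h']
  intro h0
  rw [h0, Submodule.mem_bot] at hf
  have h1 : f (e 1) = 1 := by
    have h : (⟨1, one_mem _⟩ : Subgroup.center G) = 1 := rfl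
    simp [f, one_mem, h]
  simp [hf] at h1

theorem exists_injective_monoidHom_units_of_isCyclic (C : Type*) [Group C] [Finite C]
    [IsCyclic C] : ∃ χ : C →* ℂˣ, Function.Injective χ := by
  have : NeZero (Nat.card C) := ⟨Nat.card_pos.ne'⟩
  have e : C ≃* rootsOfUnity (Nat.card C) ℂ := mulEquivOfCyclicCardEq <| by
    rw [Complex.card_rootsOfUnity]
  exact ⟨(Subgroup.subtype _).comp e.toMonoidHom, Subtype.val_injective.comp e.injective⟩

section ClassTwo

open scoped commutatorElement

variable {G V : Type*} [Group G] [AddCommGroup V] [Module ℂ V] {ρ : Representation ℂ G V}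
  {χ : Subgroup.center G →* ℂˣ}

theorem injective_of_central_character_injective [Nontrivial V]
    (hG : commutator G ≤ Subgroup.center G) (hχ : Function.Injective χ)
    (hρ : ∀ (z : Subgroup.center G) v, ρ z v = (χ z : ℂ) • v) : Function.Injective ρ := by
  have key : ∀ z : Subgroup.center G, ρ z = 1 → z = 1 := fun z hz => by
    obtain ⟨v, hv⟩ := exists_ne (0 : V)
    have h1 : (χ z : ℂ) • v = (1 : ℂ) • v := by rw [← hρ, hz, one_smul, Module.End.one_apply]
    exact hχ (by rw [map_one]; exact Units.ext (smul_left_injective ℂ hv h1))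
  have ker_eq : ∀ g, ρ g = 1 → g = 1 := fun g hg => by
    have hc : g ∈ Subgroup.center G := Subgroup.mem_center_iff.2 fun h => by
      have hz : ⁅h, g⁆ ∈ Subgroup.center G :=
        hG (Subgroup.commutator_mem_commutator (Subgroup.mem_top h) (Subgroup.mem_top g))
      have h1 : ρ ⁅h, g⁆ = 1 := by
        have hi : ρ g⁻¹ = 1 := by
          rw [← mul_one (ρ g⁻¹), ← hg, ← map_mul, inv_mul_cancel, map_one, hg]
        rw [commutatorElement_def, map_mul, map_mul, map_mul, hg, hi, mul_one, mul_one,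
          ← map_mul, mul_inv_cancel, map_one]
      exact commutatorElement_eq_one_iff_mul_comm.1 (congrArg Subtype.val (key ⟨_, hz⟩ h1))
    exact congrArg Subtype.val (key ⟨g, hc⟩ hg)
  intro g h hgh
  refine eq_of_mul_inv_eq_one (ker_eq _ ?_)
  rw [map_mul, hgh, ← map_mul, mul_inv_cancel, map_one]

theorem character_eq_zero_of_notMem_center (hG : commutator G ≤ Subgroup.center G)
    (hχ : Function.Injective χ) (hρ : ∀ (z : Subgroup.center G) v, ρ z v = (χ z : ℂ) • v)
    {g : G} (hg : g ∉ Subgroup.center G) : ρ.character g = 0 := by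
  obtain ⟨h, hh⟩ := not_forall.1 (mt Subgroup.mem_center_iff.2 hg)
  have hz : ⁅h, g⁆ ∈ Subgroup.center G :=
    hG (Subgroup.commutator_mem_commutator (Subgroup.mem_top h) (Subgroup.mem_top g))
  have h1 : ρ.character g = (χ ⟨_, hz⟩ : ℂ) * ρ.character g := by
    conv_lhs => rw [← Representation.char_conj ρ g h]
    have : ρ (h * g * h⁻¹) = (χ ⟨_, hz⟩ : ℂ) • ρ g := by
      ext v
      rw [LinearMap.smul_apply, ← hρ ⟨_, hz⟩, ← Module.End.mul_apply, ← map_mul]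
      simp [commutatorElement_def]
    rw [Representation.character, this, map_smul, smul_eq_mul, Representation.character]
  by_contra h0
  have h2 : (χ ⟨_, hz⟩ : ℂ) = 1 := (mul_eq_right₀ h0).1 h1.symm
  have h3 : (⟨_, hz⟩ : Subgroup.center G) = 1 := hχ (by rw [map_one]; exact Units.ext h2)
  exact hh (commutatorElement_eq_one_iff_mul_comm.1 (congrArg Subtype.val h3))

theorem finrank_sq_eq_index_center [Fintype G] [FiniteDimensional ℂ V] [ρ.IsIrreducible]
    (hG : commutator G ≤ Subgroup.center G) (hχ : Function.Injective χ)
    (hρ : ∀ (z : Subgroup.center G) v, ρ z v = (χ z : ℂ) • v) :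
    Module.finrank ℂ V ^ 2 = (Subgroup.center G).index := by
  classical
  have hchar : ∀ z : Subgroup.center G, ρ.character z = (χ z : ℂ) * Module.finrank ℂ V := by
    intro z
    have : ρ z = (χ z : ℂ) • LinearMap.id := LinearMap.ext (hρ z)
    rw [Representation.character, this, map_smul, LinearMap.trace_id, smul_eq_mul]
  have hcard : (Nat.card G : ℂ) ≠ 0 := Nat.cast_ne_zero.2 Nat.card_pos.ne'
  let _ := invertibleOfNonzero hcard
  have horth := Representation.card_inv_mul_sum_char_mul_char_eq_finrank ρ ρ
  rw [Representation.IsIrreducible.finrank_intertwiningMap_self, Nat.cast_one,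
    inv_mul_eq_one₀ hcard] at horth
  have hsum : ∑ g : G, ρ.character g * ρ.character g⁻¹ =
      Nat.card (Subgroup.center G) * (Module.finrank ℂ V : ℂ) ^ 2 := by
    rw [← Finset.sum_subset (Finset.subset_univ (Finset.univ.filter (· ∈ Subgroup.center G)))
      fun g _ hg => by
        rw [character_eq_zero_of_notMem_center hG hχ hρ (by simpa using hg), zero_mul],
      Finset.sum_congr rfl (g := fun _ => (Module.finrank ℂ V : ℂ) ^ 2), Finset.sum_const,
      nsmul_eq_mul, Nat.card_eq_fintype_card, Fintype.card_subtype]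
    intro g hg
    have hg : g ∈ Subgroup.center G := by simpa using hg
    have hmul := hchar ⟨g, hg⟩
    have hinv := hchar (⟨g, hg⟩⁻¹)
    have hne : (χ ⟨g, hg⟩ : ℂ) ≠ 0 := Units.ne_zero _
    rw [map_inv, Units.val_inv_eq_inv_val] at hinv
    simp only [InvMemClass.coe_inv] at hmul hinv
    rw [hmul, hinv]
    field_simp
  have hnat : Nat.card (Subgroup.center G) * Module.finrank ℂ V ^ 2 =
      Nat.card (Subgroup.center G) * (Subgroup.center G).index := by
    rw [Subgroup.card_mul_index]
    exact_mod_cast (horth.trans hsum).symm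
  exact Nat.eq_of_mul_eq_mul_left Nat.card_pos hnat

end ClassTwo

/-- A nonabelian finite group that is nilpotent of class 2
(`E' ⊆ Z(E)`) with cyclic center has a faithful irreducible complex representation,
and its degree is `[E : Z(E)]^{1/2}`. -/
theorem class_two_cyclic_center_faithful_irrep
    {E : Type*} [Group E] [Fintype E]
    (hnab : ∃ a b : E, a * b ≠ b * a)
    (hE : commutator E ≤ Subgroup.center E)
    (hcyc : IsCyclic ↥(Subgroup.center E)) :
    ∃ (V : Type) (_ : AddCommGroup V) (_ : Module ℂ V)
      (ρ : Representation ℂ E V),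
      FiniteDimensional ℂ V ∧ RepIrreducible ρ ∧ Function.Injective ρ ∧
        Module.finrank ℂ V ^ 2 = (Subgroup.center E).index := by
  obtain ⟨χ, hχ⟩ := exists_injective_monoidHom_units_of_isCyclic (Subgroup.center E)
  obtain ⟨τ, hτ, hirr⟩ := Subrepresentation.exists_le_repIrreducible _
    (centralIsotypic_rightRegular_ne_bot (Fintype.equivFin E) χ)
  have hcentral : ∀ (z : Subgroup.center E) v, τ.toRepresentation z v = (χ z : ℂ) • v :=
    fun z v => Subtype.ext (mem_centralIsotypic.1 (hτ v.2) z)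
  have := hirr.isIrreducible
  have : Nontrivial τ.toSubmodule := (Submodule.nontrivial_iff ℂ).1 ⟨⊤, ⊥, hirr.1⟩
  exact ⟨τ.toSubmodule, inferInstance, inferInstance, τ.toRepresentation, inferInstance, hirr,
    injective_of_central_character_injective hE hχ hcentral,
    finrank_sq_eq_index_center hE hχ hcentral⟩
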